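/- Let D = A_3 = ℂ⟨x,y,z,∂_x,∂_y,∂_z⟩ and M = D/(D∂_x + D∂_y + D(z³∂_z + z)). Then the localization M[1/z] := ℂ[x,y,z][1/z] ⊗_{ℂ[x,y,z]} M is isomorphic as a left D-module to D/(D∂_x + D∂_y + D(z²∂_z + z + 1)). Moreover, the map z : M → M is not injective. -/

import Mathlib

open MvPolynomial

noncomputable section

set_option maxHeartbeats 1000000
set_option synthInstance.maxHeartbeats 1000000

/-- The Weyl algebra `A_3 = ℂ⟨x,y,z,∂_x,∂_y,∂_z⟩`, realized as operators on `ℂ[x,y,z]`. -/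
def weylAlg3 : Subalgebra ℂ (Module.End ℂ (MvPolynomial (Fin 3) ℂ)) :=
  Algebra.adjoin ℂ
    ((Set.range fun i : Fin 3 => (LinearMap.mulLeft ℂ (X i))) ∪
     (Set.range fun i : Fin 3 => (pderiv i).toLinearMap))

def D3 : Type := ↥weylAlg3
instance : Ring D3 := inferInstanceAs (Ring ↥weylAlg3)
instance : Algebra ℂ D3 := inferInstanceAs (Algebra ℂ ↥weylAlg3)

/-- The coordinate operators `x, y, z ∈ D`. -/
def xA (i : Fin 3) : D3 :=
  (⟨LinearMap.mulLeft ℂ (X i),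
    Algebra.subset_adjoin (Set.mem_union_left _ ⟨i, rfl⟩)⟩ : ↥weylAlg3)

/-- The derivations `∂_x, ∂_y, ∂_z ∈ D`. -/
def dA (i : Fin 3) : D3 :=
  (⟨(pderiv i).toLinearMap,
    Algebra.subset_adjoin (Set.mem_union_right _ ⟨i, rfl⟩)⟩ : ↥weylAlg3)

/-- `M = D/(D∂_x + D∂_y + D(z³∂_z + z))`. -/
def Mmod : Type :=
  D3 ⧸ (Submodule.span D3 {dA 0, dA 1, (xA 2) ^ 3 * dA 2 + xA 2} : Submodule D3 D3)
instance : AddCommGroup Mmod :=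
  inferInstanceAs (AddCommGroup (D3 ⧸ (Submodule.span D3 {dA 0, dA 1, (xA 2) ^ 3 * dA 2 + xA 2})))
instance : Module D3 Mmod :=
  inferInstanceAs (Module D3 (D3 ⧸ (Submodule.span D3 {dA 0, dA 1, (xA 2) ^ 3 * dA 2 + xA 2})))

/-- `D/(D∂_x + D∂_y + D(z²∂_z + z + 1))`. -/
def Nmod : Type :=
  D3 ⧸ (Submodule.span D3 {dA 0, dA 1, (xA 2) ^ 2 * dA 2 + xA 2 + 1} : Submodule D3 D3)
instance : AddCommGroup Nmod :=
  inferInstanceAs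
    (AddCommGroup (D3 ⧸ (Submodule.span D3 {dA 0, dA 1, (xA 2) ^ 2 * dA 2 + xA 2 + 1})))
instance : Module D3 Nmod :=
  inferInstanceAs
    (Module D3 (D3 ⧸ (Submodule.span D3 {dA 0, dA 1, (xA 2) ^ 2 * dA 2 + xA 2 + 1})))

lemma lmul_mem (p : MvPolynomial (Fin 3) ℂ) :
    Algebra.lmul ℂ (MvPolynomial (Fin 3) ℂ) p ∈ weylAlg3 := by
  have h : p ∈ (Algebra.adjoin ℂ (Set.range (X : Fin 3 → MvPolynomial (Fin 3) ℂ))) := by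
    rw [MvPolynomial.adjoin_range_X]; trivial
  induction h using Algebra.adjoin_induction with
  | mem x hx =>
      obtain ⟨i, rfl⟩ := hx
      exact Algebra.subset_adjoin (Set.mem_union_left _ ⟨i, rfl⟩)
  | algebraMap r =>
      rw [AlgHom.commutes]
      exact Subalgebra.algebraMap_mem _ r
  | add a b ha hb hma hmb => rw [map_add]; exact Subalgebra.add_mem _ hma hmb
  | mul a b ha hb hma hmb => rw [map_mul]; exact Subalgebra.mul_mem _ hma hmb

/-- The inclusion `ℂ[x,y,z] ⊆ A_3` (each polynomial acting by multiplication). -/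
def inclR : MvPolynomial (Fin 3) ℂ →+* D3 :=
  (AlgHom.codRestrict (Algebra.lmul ℂ (MvPolynomial (Fin 3) ℂ)) weylAlg3 lmul_mem).toRingHom

/-- Every left `D`-module is a `ℂ[x,y,z]`-module via `ℂ[x,y,z] ⊆ D`. -/
instance modR (L : Type) [AddCommGroup L] [Module D3 L] : Module (MvPolynomial (Fin 3) ℂ) L :=
  Module.compHom _ inclR

end

section helpers

abbrev R3 := MvPolynomial (Fin 3) ℂ

/-- A differential operator viewed as an endomorphism of `ℂ[x,y,z]`. -/
noncomputable def opE : D3 →ₐ[ℂ] Module.End ℂ R3 := weylAlg3.val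

lemma opE_inj : Function.Injective opE := Subtype.val_injective

@[simp] lemma opE_xA (i : Fin 3) (p : R3) : opE (xA i) p = X i * p := rfl
@[simp] lemma opE_dA (i : Fin 3) (p : R3) : opE (dA i) p = pderiv i p := rfl
@[simp] lemma opE_inclR (q p : R3) : opE (inclR q) p = q * p := rfl

lemma inclR_X (i : Fin 3) : inclR (X i) = xA i := rfl

lemma D3_induction {P : D3 → Prop} (hx : ∀ i, P (xA i)) (hd : ∀ i, P (dA i))
    (hc : ∀ r : ℂ, P (inclR (C r))) (hadd : ∀ a b, P a → P b → P (a + b))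
    (hmul : ∀ a b, P a → P b → P (a * b)) (a : D3) : P a := by
  obtain ⟨a, ha⟩ := a
  induction ha using Algebra.adjoin_induction with
  | mem x hx' =>
    rcases hx' with ⟨i, rfl⟩ | ⟨i, rfl⟩
    · exact hx i
    · exact hd i
  | algebraMap r =>
    have e : (algebraMap ℂ D3 r) = inclR (C r) := by
      apply opE_inj
      apply LinearMap.ext
      intro p
      rw [opE_inclR, ← MvPolynomial.smul_eq_C_mul]
      rfl
    have := hc r
    rw [← e] at this
    exact this
  | add a b ha hb iha ihb => exact hadd _ _ iha ihb
  | mul a b ha hb iha ihb => exact hmul _ _ iha ihb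

lemma dA_inclR (i : Fin 3) (p : R3) :
    dA i * inclR p = inclR p * dA i + inclR (pderiv i p) := by
  apply opE_inj
  apply LinearMap.ext
  intro q
  simp only [map_mul, map_add, Module.End.mul_apply, LinearMap.add_apply, opE_dA, opE_inclR,
    Derivation.leibniz, smul_eq_mul]
  ring

/-- `z - 1` -/
noncomputable def tt : R3 := X 2 - 1

lemma order_bound (a : D3) : ∃ d : ℕ, ∀ (n : ℕ) (p : R3), tt ^ (n + d) ∣ p → tt ^ n ∣ opE a p := by
  induction a using D3_induction with
  | hx i => exact ⟨0, fun n p h => by rw [opE_xA]; exact Dvd.dvd.mul_left h _⟩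
  | hc r => exact ⟨0, fun n p h => by rw [opE_inclR]; exact Dvd.dvd.mul_left h _⟩
  | hd i =>
    refine ⟨1, fun n p h => ?_⟩
    obtain ⟨q, rfl⟩ := h
    rw [opE_dA, Derivation.leibniz, Derivation.leibniz_pow]
    simp only [smul_eq_mul, nsmul_eq_mul, Nat.add_sub_cancel]
    refine dvd_add ⟨tt * pderiv i q, by ring⟩ ⟨q * ((n + 1 : ℕ) * pderiv i tt), by ring⟩
  | hadd a b iha ihb =>
    obtain ⟨d, hd⟩ := iha
    obtain ⟨e, he⟩ := ihb
    refine ⟨d + e, fun n p h => ?_⟩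
    rw [map_add, LinearMap.add_apply]
    exact dvd_add (hd n p ((pow_dvd_pow _ (by omega)).trans h))
      (he n p ((pow_dvd_pow _ (by omega)).trans h))
  | hmul a b iha ihb =>
    obtain ⟨d, hd⟩ := iha
    obtain ⟨e, he⟩ := ihb
    refine ⟨d + e, fun n p h => ?_⟩
    rw [map_mul, Module.End.mul_apply]
    exact hd n _ (he (n + d) p (by rwa [← add_assoc] at h))

lemma approx1 (s : ℂ) (N : ℕ) : ∃ h : Polynomial ℂ, h.eval 1 = 1 ∧
    (Polynomial.X - 1) ^ N ∣
      Polynomial.X ^ 3 * Polynomial.derivative h + Polynomial.X * h - Polynomial.C s := by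
  induction N with
  | zero => exact ⟨1, by simp, by simp⟩
  | succ N ih =>
    obtain ⟨h, h1, g, hg⟩ := ih
    have hN : ((N : ℂ) + 1) ≠ 0 := by exact_mod_cast Nat.succ_ne_zero N
    set c : ℂ := - g.eval 1 / (N + 1) with hc
    refine ⟨h + Polynomial.C c * (Polynomial.X - 1) ^ (N + 1), by simp [h1], ?_⟩
    have key : (Polynomial.X - 1 : Polynomial ℂ) ∣
        g + Polynomial.C c * ((N : Polynomial ℂ) + 1) * Polynomial.X ^ 3 := by
      rw [← Polynomial.C_1, Polynomial.dvd_iff_isRoot]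
      simp only [Polynomial.IsRoot, Polynomial.eval_add, Polynomial.eval_mul, Polynomial.eval_C,
        Polynomial.eval_pow, Polynomial.eval_X, Polynomial.eval_natCast, Polynomial.eval_one]
      rw [hc]; field_simp; ring
    obtain ⟨q, hq⟩ := key
    have e : Polynomial.derivative ((Polynomial.X - 1 : Polynomial ℂ) ^ (N + 1))
        = ((N : Polynomial ℂ) + 1) * (Polynomial.X - 1) ^ N := by
      rw [Polynomial.derivative_pow]; simp
    refine ⟨q + Polynomial.X * Polynomial.C c, ?_⟩
    rw [Polynomial.derivative_add, Polynomial.derivative_C_mul, e]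
    linear_combination hg + (Polynomial.X - 1) ^ N * hq

lemma pderiv_aeval (i : Fin 3) (h : Polynomial ℂ) :
    pderiv i (Polynomial.aeval (X 2 : R3) h)
      = Polynomial.aeval (X 2 : R3) (Polynomial.derivative h) * pderiv i (X 2 : R3) := by
  induction h using Polynomial.induction_on' with
  | add p q hp hq => simp only [map_add, hp, hq]; ring
  | monomial n a =>
    simp only [Polynomial.aeval_monomial, Polynomial.derivative_monomial, Derivation.leibniz,
      Derivation.leibniz_pow, smul_eq_mul, nsmul_eq_mul, MvPolynomial.algebraMap_eq, pderiv_C,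
      map_mul, map_natCast]
    ring

noncomputable abbrev P3 : D3 := (xA 2) ^ 3 * dA 2 + xA 2

lemma opE_P3 (h : R3) : opE P3 h = X 2 ^ 3 * pderiv 2 h + X 2 * h := by
  rw [P3, map_add, map_mul, LinearMap.add_apply, Module.End.mul_apply, opE_dA, opE_xA,
    ← inclR_X, ← map_pow, opE_inclR]

lemma approx (s : ℂ) (N : ℕ) : ∃ h : R3, tt ∣ h - 1 ∧ opE (dA 0) h = 0 ∧ opE (dA 1) h = 0 ∧
    tt ^ N ∣ opE P3 h - C s := by
  obtain ⟨h, h1, h2⟩ := approx1 s N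
  refine ⟨Polynomial.aeval (X 2 : R3) h, ?_, ?_, ?_, ?_⟩
  · have : (Polynomial.X - Polynomial.C 1 : Polynomial ℂ) ∣ h - 1 := by
      rw [Polynomial.dvd_iff_isRoot]; simp [h1]
    simpa [tt] using map_dvd (Polynomial.aeval (X 2 : R3)) this
  · rw [opE_dA, pderiv_aeval, pderiv_X_of_ne (by decide), mul_zero]
  · rw [opE_dA, pderiv_aeval, pderiv_X_of_ne (by decide), mul_zero]
  · have := map_dvd (Polynomial.aeval (X 2 : R3)) h2
    simp only [map_pow, map_sub, map_add, map_mul, Polynomial.aeval_X, map_one,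
      Polynomial.aeval_C, MvPolynomial.algebraMap_eq] at this
    rw [opE_P3, pderiv_aeval, pderiv_X_self, mul_one]
    exact this

lemma tt_eval (p : R3) (a : Fin 3 → ℂ) (ha : a 2 = 1) (h : tt ∣ p) : eval a p = 0 := by
  obtain ⟨q, rfl⟩ := h
  simp [tt, ha]

lemma eq_zero_of_tt (p : R3) (h : ∀ n, tt ^ n ∣ p) : p = 0 := by
  by_contra hp
  have hu : ¬ IsUnit tt := by
    intro hu
    have := tt_eval 1 (fun _ => 1) rfl hu.dvd
    simp at this
  obtain ⟨n, hn⟩ := FiniteMultiplicity.of_not_isUnit hu hp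
  exact hn (h _)

lemma mem_J {Q : D3} {a : D3} (h : a ∈ (Submodule.span D3 {dA 0, dA 1, Q} : Submodule D3 D3)) :
    ∃ b c e : D3, a = b * dA 0 + c * dA 1 + e * Q := by
  rw [Submodule.mem_span_insert] at h
  obtain ⟨b, y, hy, rfl⟩ := h
  rw [Submodule.mem_span_pair] at hy
  obtain ⟨c, e, rfl⟩ := hy
  exact ⟨b, c, e, by simp only [smul_eq_mul, add_assoc]⟩

/-- a polynomial in the left ideal defining `M` is zero -/
lemma inclR_mem (p : R3) (h : inclR p ∈ (Submodule.span D3 {dA 0, dA 1, P3} : Submodule D3 D3)) :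
    p = 0 := by
  obtain ⟨b, c, e, he⟩ := mem_J h
  obtain ⟨d, hd⟩ := order_bound e
  apply eq_zero_of_tt
  intro n
  obtain ⟨h, h1, h2, h3, h4⟩ := approx 0 (n + d)
  have := congrArg (fun a => opE a h) he
  simp only [map_add, map_mul, LinearMap.add_apply, Module.End.mul_apply, h2, h3, opE_inclR,
    map_zero, zero_add] at this
  have h5 : tt ^ n ∣ p * h := by
    rw [this]
    simp only [map_zero, sub_zero] at h4
    have := hd n _ h4
    simpa only [map_add, map_mul, LinearMap.add_apply, Module.End.mul_apply] using this
  have hco : IsCoprime tt h := by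
    obtain ⟨q, hq⟩ := h1
    exact ⟨-q, 1, by linear_combination hq⟩
  exact (hco.pow_left).dvd_of_dvd_mul_right h5

lemma Q_not_mem : (xA 2) ^ 2 * dA 2 + 1 ∉
    (Submodule.span D3 {dA 0, dA 1, P3} : Submodule D3 D3) := by
  intro h
  obtain ⟨b, c, e, he⟩ := mem_J h
  obtain ⟨d, hd⟩ := order_bound e
  have key : X 2 * opE e 1 - 1 = (0 : R3) := by
    apply eq_zero_of_tt
    intro n
    obtain ⟨h, h1, h2, h3, h4⟩ := approx 1 (n + d)
    have h6 := congrArg (fun a => opE (xA 2 * a) h) he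
    have h7 : opE (xA 2 * ((xA 2) ^ 2 * dA 2 + 1)) h = opE P3 h := by
      have : xA 2 * ((xA 2) ^ 2 * dA 2 + 1) = P3 := by
        rw [P3]; noncomm_ring
      rw [this]
    have h8 : opE (xA 2 * (b * dA 0 + c * dA 1 + e * P3)) h = X 2 * opE e (opE P3 h) := by
      rw [map_mul, Module.End.mul_apply, opE_xA, map_add, map_add, map_mul, map_mul, map_mul]
      simp only [LinearMap.add_apply, Module.End.mul_apply, h2, h3, map_zero, zero_add]
    replace h6 : opE P3 h = X 2 * opE e (opE P3 h) := by
      exact h7.symm.trans (h6.trans h8)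
    have h9 := hd n _ h4
    rw [map_sub] at h9
    have h10 : tt ^ n ∣ opE P3 h - C 1 := (pow_dvd_pow _ (by omega)).trans h4
    rw [C_1] at h9 h10
    have := dvd_sub h10 (Dvd.dvd.mul_left h9 (X 2))
    convert this using 1
    linear_combination -h6
  have := congrArg (eval (fun _ => (0 : ℂ))) key
  simp at this

lemma dz (i : Fin 3) (hi : i ≠ 2) : dA i * xA 2 = xA 2 * dA i := by
  have := dA_inclR i (X 2)
  rwa [pderiv_X_of_ne hi.symm, map_zero, add_zero] at this

lemma dz2 : dA 2 * xA 2 = xA 2 * dA 2 + 1 := by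
  have := dA_inclR 2 (X 2)
  rwa [pderiv_X_self, map_one] at this

section N

noncomputable abbrev QN : D3 := (xA 2) ^ 2 * dA 2 + xA 2 + 1
noncomputable abbrev JN : Submodule D3 D3 := Submodule.span D3 {dA 0, dA 1, QN}
noncomputable abbrev JM : Submodule D3 D3 := Submodule.span D3 {dA 0, dA 1, P3}

noncomputable def piN : D3 →ₗ[D3] Nmod := JN.mkQ
noncomputable def piM : D3 →ₗ[D3] Mmod := JM.mkQ

lemma piN_surj : Function.Surjective piN := Submodule.mkQ_surjective JN
lemma piM_surj : Function.Surjective piM := Submodule.mkQ_surjective JM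
lemma piN_zero (a : D3) : piN a = 0 ↔ a ∈ JN := Submodule.Quotient.mk_eq_zero JN
lemma piM_zero (a : D3) : piM a = 0 ↔ a ∈ JM := Submodule.Quotient.mk_eq_zero JM

noncomputable def vN : Nmod := piN 1
lemma piN_eq (a : D3) : piN a = a • vN := by
  rw [vN, ← map_smul, smul_eq_mul, mul_one]

lemma vN_d (i : Fin 3) (hi : i ≠ 2) : dA i • vN = 0 := by
  rw [← piN_eq, piN_zero]
  apply Submodule.subset_span
  fin_cases i <;> simp at hi ⊢

lemma vN_Q : QN • vN = 0 := by
  rw [← piN_eq, piN_zero]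
  apply Submodule.subset_span
  simp

/-- the elements `z^{-k} v` of `N` -/
noncomputable def nn : ℕ → Nmod
  | 0 => vN
  | 1 => -(dA 2 • xA 2 • vN)
  | (k + 2) => -(dA 2 • nn k) - (k + 1 : ℕ) • nn (k + 1)

lemma z_nn (k : ℕ) : xA 2 • nn (k + 1) = nn k := by
  induction k using Nat.strong_induction_on with
  | _ k ih =>
  match k with
  | 0 =>
    have h := vN_Q
    have e : xA 2 * (dA 2 * xA 2) = QN - 1 := by
      rw [dz2, QN]; noncomm_ring
    simp only [nn, smul_neg, ← mul_smul]
    rw [e, sub_smul, h]; simp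
  | 1 =>
    have h0 := ih 0 (by omega)
    simp only [zero_add] at h0
    have e : dA 2 • xA 2 • vN = xA 2 • dA 2 • vN + vN := by
      rw [← mul_smul, dz2, add_smul, mul_smul, one_smul]
    show xA 2 • (-(dA 2 • nn 0) - (0 + 1 : ℕ) • nn 1) = -(dA 2 • xA 2 • vN)
    rw [smul_sub, smul_comm (xA 2) (0 + 1 : ℕ), h0, e]
    simp only [nn, smul_neg, zero_add, one_smul]
    abel
  | (k + 2) =>
    have h1 := ih (k + 1) (by omega)
    have h0 := ih k (by omega)
    have e : xA 2 • dA 2 • nn (k + 1) = dA 2 • nn k - nn (k + 1) := by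
      rw [← h0, ← mul_smul, ← mul_smul, dz2, add_smul, one_smul]; abel
    show xA 2 • (-(dA 2 • nn (k + 1)) - (k + 1 + 1 : ℕ) • nn (k + 2))
      = -(dA 2 • nn k) - (k + 1 : ℕ) • nn (k + 1)
    rw [smul_sub, smul_comm (xA 2) (k + 1 + 1 : ℕ), h1, smul_neg, e, succ_nsmul _ (k + 1)]
    abel

lemma zpow_nn (j k : ℕ) : (xA 2) ^ j • nn (k + j) = nn k := by
  induction j with
  | zero => simp
  | succ j ih => rw [pow_succ, mul_smul, ← add_assoc, z_nn, ih]

lemma d_nn (i : Fin 3) (hi : i ≠ 2) (k : ℕ) : dA i • nn k = 0 := by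
  have hc : dA i * dA 2 = dA 2 * dA i := by
    apply opE_inj
    apply LinearMap.ext
    intro p
    simp only [map_mul, Module.End.mul_apply, opE_dA]
    have h : ⁅(pderiv i : Derivation ℂ R3 R3), (pderiv 2 : Derivation ℂ R3 R3)⁆ = 0 := by
      apply MvPolynomial.derivation_ext
      intro j
      rw [Derivation.commutator_apply, pderiv_X, pderiv_X]
      simp only [Pi.single_apply]
      split_ifs <;> simp
    have h' := congrArg (fun d : Derivation ℂ R3 R3 => d p) h
    simp only [Derivation.commutator_apply] at h'
    exact sub_eq_zero.mp h'
  induction k using Nat.strong_induction_on with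
  | _ k ih =>
  match k with
  | 0 => exact vN_d i hi
  | 1 =>
    show dA i • (-(dA 2 • xA 2 • vN)) = 0
    rw [smul_neg, ← mul_smul, hc, mul_smul, ← mul_smul (dA i), dz i hi, mul_smul, vN_d i hi]
    simp
  | (k + 2) =>
    show dA i • (-(dA 2 • nn k) - (k + 1 : ℕ) • nn (k + 1)) = 0
    rw [smul_sub, smul_neg, ← mul_smul, hc, mul_smul, ih k (by omega), smul_comm,
      ih (k + 1) (by omega)]
    simp

lemma d2_nn (k : ℕ) : dA 2 • nn k = -(nn (k + 2)) - (k + 1 : ℕ) • nn (k + 1) := by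
  have : nn (k + 2) = -(dA 2 • nn k) - (k + 1 : ℕ) • nn (k + 1) := rfl
  rw [this]; abel

def SN (n : Nmod) : Prop := ∃ (p : R3) (k : ℕ), n = inclR p • nn k

lemma SN_lift (p : R3) (k j : ℕ) : inclR p • nn k = inclR (p * X 2 ^ j) • nn (k + j) := by
  rw [map_mul, map_pow, inclR_X, mul_smul, zpow_nn]

lemma SN_add {m n : Nmod} (hm : SN m) (hn : SN n) : SN (m + n) := by
  obtain ⟨p, k, rfl⟩ := hm
  obtain ⟨q, l, rfl⟩ := hn
  refine ⟨p * X 2 ^ l + q * X 2 ^ k, k + l, ?_⟩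
  rw [SN_lift p k l, SN_lift q l k, map_add, add_smul, add_comm l k]

lemma SN_R {m : Nmod} (q : R3) (hm : SN m) : SN (inclR q • m) := by
  obtain ⟨p, k, rfl⟩ := hm
  exact ⟨q * p, k, by rw [map_mul, mul_smul]⟩

lemma SN_nn (k : ℕ) : SN (nn k) := ⟨1, k, by simp⟩

lemma SN_zero : SN 0 := ⟨0, 0, by simp⟩

lemma SN_dnn (i : Fin 3) (k : ℕ) : SN (dA i • nn k) := by
  by_cases hi : i = 2
  · subst hi
    have e : dA 2 • nn k = inclR (C (-1)) • nn (k + 2) + inclR (-((k + 1 : ℕ) : R3)) • nn (k + 1) := by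
      rw [d2_nn, C_neg, C_1, map_neg, map_neg, map_one, map_natCast, neg_smul, neg_smul, one_smul,
        Nat.cast_smul_eq_nsmul]
      abel
    rw [e]
    exact SN_add (SN_R _ (SN_nn _)) (SN_R _ (SN_nn _))
  · rw [d_nn i hi]; exact SN_zero

lemma SN_smul (a : D3) : ∀ n, SN n → SN (a • n) := by
  induction a using D3_induction with
  | hx i => exact fun n hn => SN_R (X i) hn
  | hc r => exact fun n hn => SN_R _ hn
  | hd i =>
    rintro _ ⟨p, k, rfl⟩
    rw [← mul_smul, dA_inclR, add_smul, mul_smul]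
    exact SN_add (SN_R _ (SN_dnn i k)) (SN_R _ (SN_nn k))
  | hadd a b iha ihb => exact fun n hn => by rw [add_smul]; exact SN_add (iha n hn) (ihb n hn)
  | hmul a b iha ihb => exact fun n hn => by rw [mul_smul]; exact iha _ (ihb n hn)

lemma SN_all (n : Nmod) : SN n := by
  obtain ⟨a, rfl⟩ := piN_surj n
  rw [piN_eq]
  exact SN_smul a _ (SN_nn 0)

lemma zN_surj (j : ℕ) (n : Nmod) : ∃ n', (xA 2) ^ j • n' = n := by
  obtain ⟨p, k, rfl⟩ := SN_all n
  refine ⟨inclR p • nn (k + j), ?_⟩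
  rw [← inclR_X, ← map_pow, ← mul_smul, ← map_mul, mul_comm, map_mul, mul_smul, map_pow, inclR_X,
    zpow_nn]

end N

end helpers

/-- for `M = D/(D∂_x + D∂_y + D(z³∂_z + z))` over `D = A_3`:
the map `z : M → M` is not injective, and any left `D`-module `L` receiving a `D`-linear
map from `M` which realizes `L` as the localization `M[1/z] = ℂ[x,y,z][1/z] ⊗ M` is
isomorphic as a left `D`-module to `D/(D∂_x + D∂_y + D(z²∂_z + z + 1))`. -/
theorem stmt_17 :
    (¬ Function.Injective fun m : Mmod => (xA 2) • m) ∧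
    (∀ (L : Type) [AddCommGroup L] [Module D3 L]
        (f : Mmod →ₗ[MvPolynomial (Fin 3) ℂ] L),
      (∀ (a : D3) (m : Mmod), f (a • m) = a • f m) →
      IsLocalizedModule (Submonoid.powers (X 2 : MvPolynomial (Fin 3) ℂ)) f →
      Nonempty (L ≃ₗ[D3] Nmod)) := by
  constructor
  · intro hinj
    apply Q_not_mem
    rw [← piM_zero]
    apply hinj
    simp only [smul_zero]
    rw [← map_smul, piM_zero]
    apply Submodule.subset_span
    have : xA 2 • ((xA 2) ^ 2 * dA 2 + 1) = P3 := by
      rw [P3, smul_eq_mul]; noncomm_ring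
    rw [this]; simp
  · intro L _ _ f hf hloc
    have hzpow : ∀ k : ℕ, Function.Bijective fun l : L => (xA 2) ^ k • l := by
      intro k
      have h1 := hloc.map_units ⟨X 2 ^ k, k, rfl⟩
      have h2 := (Module.End.isUnit_iff _).mp h1
      convert h2 using 2 with l
      show _ = inclR (X 2 ^ k) • l
      rw [map_pow, inclR_X]
    have hz : Function.Bijective fun l : L => xA 2 • l := by simpa using hzpow 1
    have hcan : ∀ l : L, xA 2 • l = 0 → l = 0 := fun l h => hz.1 (by simpa using h)
    have hcank : ∀ (k : ℕ) (l : L), xA 2 ^ k • l = 0 → l = 0 :=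
      fun k l h => (hzpow k).1 (by simpa using h)
    set u : L := f (piM 1) with hu
    have hfu : ∀ a : D3, f (piM a) = a • u := by
      intro a
      rw [hu, ← hf, ← map_smul, smul_eq_mul, mul_one]
    have hJu : ∀ a ∈ JM, a • u = 0 := by
      intro a ha
      rw [← hfu, (piM_zero a).2 ha, map_zero]
    obtain ⟨w, hw⟩ := hz.2 u
    simp only at hw
    have hd : ∀ i : Fin 3, i ≠ 2 → dA i • w = 0 := by
      intro i hi
      apply hcan
      rw [← mul_smul, ← dz i hi, mul_smul, hw]
      apply hJu
      apply Submodule.subset_span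
      fin_cases i <;> simp at hi ⊢
    have hQ : QN • w = 0 := by
      apply hcank 2
      have e : xA 2 ^ 2 * QN = P3 * xA 2 := by
        have : P3 * xA 2 = xA 2 ^ 3 * (dA 2 * xA 2) + xA 2 * xA 2 := by
          rw [P3]; noncomm_ring
        rw [this, dz2, QN]; noncomm_ring
      rw [← mul_smul, e, mul_smul, hw]
      apply hJu
      apply Submodule.subset_span
      simp
    let φ : Nmod →ₗ[D3] L := JN.liftQ (LinearMap.toSpanSingleton D3 L w) (by
      rw [Submodule.span_le]
      rintro a (rfl | rfl | rfl)
      · simpa using hd 0 (by decide)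
      · simpa using hd 1 (by decide)
      · simpa using hQ)
    have hφ : φ vN = w := by
      have : φ vN = LinearMap.toSpanSingleton D3 L w 1 := Submodule.liftQ_apply _ _ _
      rw [this]; simp
    have hφinj : Function.Injective φ := by
      rw [injective_iff_map_eq_zero]
      intro n hn
      obtain ⟨p, k, rfl⟩ := SN_all n
      have h0 : inclR p • u = 0 := by
        have h1 : nn 0 = xA 2 ^ k • nn k := by
          have := zpow_nn k 0
          rw [zero_add] at this; exact this.symm
        have h2 : xA 2 ^ (k + 1) • φ (inclR p • nn k) = inclR p • u := by
          rw [← map_smul, ← inclR_X, ← map_pow, ← mul_smul, ← map_mul,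
            show X 2 ^ (k + 1) * p = p * (X 2 * X 2 ^ k) by ring, map_mul, map_mul, map_pow,
            inclR_X, mul_smul, mul_smul, ← h1, map_smul, map_smul]
          show inclR p • xA 2 • φ vN = _
          rw [hφ, hw]
        rw [← h2, hn, smul_zero]
      have h3 : f (piM (inclR p)) = f 0 := by rw [hfu, h0, map_zero]
      obtain ⟨⟨_, j, rfl⟩, hc⟩ := hloc.exists_of_eq h3
      have h4 : inclR (X 2 ^ j) • piM (inclR p) = 0 := by
        have := hc
        rw [smul_zero] at this
        exact this
      rw [← map_smul, smul_eq_mul, ← map_mul, piM_zero] at h4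
      have h5 := inclR_mem _ h4
      have h6 : p = 0 := (mul_eq_zero.mp h5).resolve_left (pow_ne_zero _ (X_ne_zero 2))
      rw [h6, map_zero, zero_smul]
    have hφsurj : Function.Surjective φ := by
      intro l
      obtain ⟨⟨m, ⟨_, j, rfl⟩⟩, hm⟩ := hloc.surj l
      have hm' : inclR (X 2 ^ j) • l = f m := hm
      rw [map_pow, inclR_X] at hm'
      obtain ⟨a, rfl⟩ := piM_surj m
      obtain ⟨n', hn'⟩ := zN_surj j (a • xA 2 • vN)
      refine ⟨n', (hzpow j).1 ?_⟩
      simp only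
      rw [hm', ← map_smul, hn', map_smul, map_smul, hφ, hw, hfu]
    exact ⟨(LinearEquiv.ofBijective φ ⟨hφinj, hφsurj⟩).symm⟩
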